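/- For every integer n ≥ 1, the sum over all fully commutative involutions w of the Coxeter group of type A_{n-1} of q^{maj(w)} equals the Gaussian binomial coefficient [n choose ⌊n/2⌋]_q, as polynomials in q. -/

import Mathlib

open CoxeterSystem

/-- A single commutation move: transposition of two adjacent letters `a`, `b`
with `M a b = 2`. -/
def CommMove {B : Type*} (M : CoxeterMatrix B) (w w' : List B) : Prop :=
  ∃ (u v : List B) (a b : B), M a b = 2 ∧ w = u ++ a :: b :: v ∧ w' = u ++ b :: a :: v

/-- Commutation equivalence of words: two words are commutation-equivalent if one can be
obtained from the other by a sequence of transpositions of adjacent commuting letters. -/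
def CommEquiv {B : Type*} (M : CoxeterMatrix B) : List B → List B → Prop :=
  Relation.EqvGen (CommMove M)

/-- An element is fully commutative if all its reduced words are commutation-equivalent. -/
def IsFullyCommutative {B W : Type*} [Group W] {M : CoxeterMatrix B}
    (cs : CoxeterSystem M W) (w : W) : Prop :=
  ∀ u v : List B, cs.IsReduced u → cs.wordProd u = w →
    cs.IsReduced v → cs.wordProd v = w → CommEquiv M u v

/-- A fully commutative involution (the identity is allowed). -/
def IsFCInvolution {B W : Type*} [Group W] {M : CoxeterMatrix B}
    (cs : CoxeterSystem M W) (w : W) : Prop :=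
  IsFullyCommutative cs w ∧ w * w = 1

/-- The Coxeter matrix of type `A_n`: generators `s_1, …, s_n` (index `k : Fin n`
corresponds to `s_{k+1}`), with `m(s_i, s_j) = 3` if `|i - j| = 1`
and `m(s_i, s_j) = 2` if `|i - j| ≥ 2`. -/
def typeA (n : ℕ) : CoxeterMatrix (Fin n) where
  M := Matrix.of fun i j : Fin n =>
    if (i : ℕ) = (j : ℕ) then 1
    else if (i : ℕ) + 1 = (j : ℕ) ∨ (j : ℕ) + 1 = (i : ℕ) then 3
    else 2
  isSymm := by
    ext i j
    simp only [Matrix.transpose_apply, Matrix.of_apply]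
    split_ifs <;> omega
  diagonal := by intro i; simp [Matrix.of_apply]
  off_diagonal := by
    intro i j hij
    have h : (i : ℕ) ≠ (j : ℕ) := fun h => hij (Fin.ext h)
    simp only [Matrix.of_apply]
    split_ifs <;> omega

/-- The right descent set of `w`, as a finset of indices: those `i` with
`ℓ(w sᵢ) < ℓ(w)`. -/
noncomputable def rightDescents {n : ℕ} {W : Type*} [Group W] {M : CoxeterMatrix (Fin n)}
    (cs : CoxeterSystem M W) (w : W) : Finset (Fin n) :=
  Finset.univ.filter fun i => cs.length (w * cs.simple i) < cs.length w

/-- The major index of `w`: the sum of the labels of its right descents, where the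
index `k : Fin n` corresponds to the generator `s_{k+1}` (hence has label `k + 1`). -/
noncomputable def majorIndex {n : ℕ} {W : Type*} [Group W] {M : CoxeterMatrix (Fin n)}
    (cs : CoxeterSystem M W) (w : W) : ℕ :=
  ∑ i ∈ rightDescents cs w, ((i : ℕ) + 1)

/-- The Gaussian binomial coefficient `[n choose k]_q` as a polynomial in `q = X` over `ℤ`,
defined via the `q`-Pascal recursion `[n+1 choose k+1]_q = [n choose k]_q
+ q^(k+1) · [n choose k+1]_q`; equivalently, it is the generating polynomial
`Σ_λ q^|λ|` over integer partitions `λ` fitting in a `k × (n-k)` box. -/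
noncomputable def qbinom : ℕ → ℕ → Polynomial ℤ
  | _, 0 => 1
  | 0, _ + 1 => 0
  | n + 1, k + 1 => qbinom n k + Polynomial.X ^ (k + 1) * qbinom n (k + 1)

section QBinomial

open Polynomial

lemma qbinom_zero_right (n : ℕ) : qbinom n 0 = 1 := by
  cases n <;> rfl

lemma qbinom_succ_succ (n k : ℕ) :
    qbinom (n + 1) (k + 1) = qbinom n k + X ^ (k + 1) * qbinom n (k + 1) := rfl

lemma qbinom_eq_zero_of_lt {n k : ℕ} (h : n < k) : qbinom n k = 0 := by
  induction n generalizing k with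
  | zero => cases k with
    | zero => omega
    | succ k => rfl
  | succ n ih => cases k with
    | zero => omega
    | succ k => rw [qbinom_succ_succ, ih (by omega), ih (by omega)]; simp

lemma qbinom_self (n : ℕ) : qbinom n n = 1 := by
  induction n with
  | zero => rfl
  | succ n ih => rw [qbinom_succ_succ, ih, qbinom_eq_zero_of_lt (Nat.lt_succ_self n)]; simp

/-- The second `q`-Pascal recursion. -/
lemma qbinom_succ_succ' {n k : ℕ} (h : k ≤ n) :
    qbinom (n + 1) (k + 1) = qbinom n (k + 1) + X ^ (n - k) * qbinom n k := by
  induction n generalizing k with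
  | zero =>
    obtain rfl : k = 0 := by omega
    simp [qbinom]
  | succ n ih =>
    rcases h.eq_or_lt with rfl | h
    · rw [qbinom_self, qbinom_self, qbinom_eq_zero_of_lt (Nat.lt_succ_self _)]; simp
    · cases k with
      | zero =>
        have e := ih (k := 0) (by omega)
        have e' := qbinom_succ_succ n 0
        rw [qbinom_succ_succ, e]
        simp only [qbinom_zero_right, Nat.sub_zero, zero_add] at e e' ⊢
        linear_combination e - e'
      | succ k =>
        have h1 := ih (k := k) (by omega)
        have h2 := ih (k := k + 1) (by omega)
        obtain ⟨d, rfl⟩ : ∃ d, n = k + 1 + d := ⟨n - (k + 1), by omega⟩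
        have h3 := qbinom_succ_succ (k + 1 + d) (k + 1)
        have h4 := qbinom_succ_succ (k + 1 + d) k
        rw [qbinom_succ_succ (k + 1 + d + 1) (k + 1)]
        rw [show k + 1 + d - k = d + 1 by omega, show k + 1 + d - (k + 1) = d by omega,
          show k + 1 + d + 1 - (k + 1) = d + 1 by omega] at *
        linear_combination h1 + X ^ (k + 2) * h2 - h3 - X ^ (d + 1) * h4

lemma qbinom_symm (a b : ℕ) : qbinom (a + b) a = qbinom (a + b) b := by
  induction h : a + b generalizing a b with
  | zero =>
    obtain rfl : a = 0 := by omega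
    obtain rfl : b = 0 := by omega
    rfl
  | succ n ih =>
    rcases a with _ | a
    · obtain rfl : b = n + 1 := by omega
      rw [qbinom_self, qbinom_zero_right]
    rcases b with _ | b
    · obtain rfl : a = n := by omega
      rw [qbinom_self, qbinom_zero_right]
    rw [qbinom_succ_succ, qbinom_succ_succ' (show b ≤ n by omega), ih a (b + 1) (by omega),
      ih (a + 1) b (by omega), show n - b = a + 1 by omega]

end QBinomial

section Paths

open Polynomial

/-- The height reached after the first `i` steps of the path with steps `t`. -/
def pathHeight {n : ℕ} (t : Fin n → SignType) (i : ℕ) : ℤ :=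
  ∑ j : Fin n, if (j : ℕ) < i then (t j : ℤ) else 0

/-- Nonnegative lattice paths with steps `±1` and `0` ending at height `h`, with
horizontal steps allowed at height zero only. -/
def IsPath {n : ℕ} (h : ℤ) (t : Fin n → SignType) : Prop :=
  (∀ i : Fin n, 0 ≤ pathHeight t (i + 1)) ∧ (∀ i : Fin n, t i = 0 → pathHeight t i = 0) ∧
    pathHeight t n = h

/-- The sum of the positions of the peaks of a path. -/
def peakSum {m : ℕ} (t : Fin (m + 1) → SignType) : ℕ :=
  ∑ i : Fin m, if t i.castSucc = 1 ∧ t i.succ = -1 then (i : ℕ) + 1 else 0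

lemma pathHeight_snoc_of_le {n : ℕ} (t : Fin n → SignType) (a : SignType) {i : ℕ} (hi : i ≤ n) :
    pathHeight (Fin.snoc t a : Fin (n + 1) → SignType) i = pathHeight t i := by
  simp [pathHeight, Fin.sum_univ_castSucc, hi]

lemma pathHeight_snoc_last {n : ℕ} (t : Fin n → SignType) (a : SignType) :
    pathHeight (Fin.snoc t a : Fin (n + 1) → SignType) (n + 1) = pathHeight t n + a := by
  simp only [pathHeight, Fin.sum_univ_castSucc, Fin.snoc_castSucc, Fin.snoc_last,
    Fin.val_castSucc, Fin.val_last]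
  congr 1
  · exact Finset.sum_congr rfl fun j _ => by simp [show (j : ℕ) < n + 1 by omega]
  · simp

lemma isPath_snoc {n : ℕ} (h : ℤ) (t : Fin n → SignType) (a : SignType) :
    IsPath h (Fin.snoc t a : Fin (n + 1) → SignType) ↔
      0 ≤ h ∧ (a = 0 → h = 0) ∧ IsPath (h - a) t := by
  have e : ∀ i : Fin n, pathHeight (Fin.snoc t a : Fin (n + 1) → SignType) (i + 1) =
      pathHeight t (i + 1) := fun i => pathHeight_snoc_of_le t a (by omega)
  have e' : ∀ i : Fin n, pathHeight (Fin.snoc t a : Fin (n + 1) → SignType) i =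
      pathHeight t i := fun i => pathHeight_snoc_of_le t a (by omega)
  simp only [IsPath, Fin.forall_fin_succ', Fin.snoc_castSucc, Fin.snoc_last, Fin.val_castSucc,
    Fin.val_last, pathHeight_snoc_last, pathHeight_snoc_of_le t a le_rfl, e, e']
  constructor
  · rintro ⟨⟨h1, h2⟩, ⟨h3, h4⟩, h5⟩
    refine ⟨by omega, fun ha => ?_, h1, h3, by omega⟩
    have := h4 ha
    subst ha
    simp at h5
    omega
  · rintro ⟨h1, h2, h3, h4, h5⟩
    refine ⟨⟨h3, by omega⟩, ⟨h4, fun ha => ?_⟩, by omega⟩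
    have := h2 ha
    subst ha
    simp at h5
    omega

lemma peakSum_snoc {m : ℕ} (t : Fin (m + 1) → SignType) (a : SignType) :
    peakSum (Fin.snoc t a : Fin (m + 2) → SignType) =
      peakSum t + if t (Fin.last m) = 1 ∧ a = -1 then m + 1 else 0 := by
  simp only [peakSum, Fin.sum_univ_castSucc, Fin.snoc_castSucc, Fin.val_castSucc, Fin.val_last,
    Fin.succ_last, Fin.succ_castSucc, Fin.snoc_last]
  

open Classical in
/-- The peak generating polynomial of the paths with `m + 1` steps ending at height `h`
with last step `a`. -/
noncomputable def pathGF (m : ℕ) (h : ℤ) (a : SignType) : ℤ[X] :=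
  ∑ t : Fin (m + 1) → SignType, if IsPath h t ∧ t (Fin.last m) = a then X ^ peakSum t else 0

lemma pathGF_eq_zero_of_isPath {m : ℕ} {h : ℤ} {a : SignType}
    (H : ∀ t : Fin (m + 1) → SignType, IsPath h t → t (Fin.last m) ≠ a) : pathGF m h a = 0 :=
  Finset.sum_eq_zero fun t _ => if_neg fun ht => H t ht.1 ht.2

lemma pathGF_eq_zero_of_neg (m : ℕ) {h : ℤ} (hh : h < 0) (a : SignType) : pathGF m h a = 0 := by
  refine pathGF_eq_zero_of_isPath fun t ht => ?_
  have h1 := ht.1 (Fin.last m)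
  have h2 := ht.2.2
  simp only [Fin.val_last] at h1
  omega

lemma pathGF_eq_zero_of_lt (m : ℕ) {h : ℤ} (hh : m + 1 < h) (a : SignType) :
    pathGF m h a = 0 := by
  refine pathGF_eq_zero_of_isPath fun t ht => ?_
  have h2 := ht.2.2
  have : pathHeight t (m + 1) ≤ ∑ j : Fin (m + 1), 1 := by
    refine Finset.sum_le_sum fun j _ => ?_
    split_ifs
    · cases t j <;> decide
    · decide
  simp at this
  omega

lemma pathGF_zero_of_pos (m : ℕ) {h : ℤ} (hh : 0 < h) : pathGF m h 0 = 0 := by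
  refine pathGF_eq_zero_of_isPath fun t ht h0 => ?_
  rw [← Fin.snoc_init_self t, isPath_snoc, h0] at ht
  have := ht.2.1 rfl
  omega

open Classical in
lemma pathGF_succ (m : ℕ) (h : ℤ) (a : SignType) :
    pathGF (m + 1) h a = if 0 ≤ h ∧ (a = 0 → h = 0) then
      pathGF m (h - a) (-1) + pathGF m (h - a) 0 +
        (if a = -1 then X ^ (m + 1) else 1) * pathGF m (h - a) 1 else 0 := by
  have key : pathGF (m + 1) h a = ∑ t : Fin (m + 1) → SignType,
      if IsPath h (Fin.snoc t a : Fin (m + 2) → SignType) then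
        (X : ℤ[X]) ^ peakSum (Fin.snoc t a : Fin (m + 2) → SignType) else 0 := by
    rw [pathGF, ← (Fin.snocEquiv fun _ : Fin (m + 2) => SignType).sum_comp,
      Fintype.sum_prod_type, Finset.sum_eq_single a]
    · refine Finset.sum_congr rfl fun t _ => ?_
      simp [Fin.snocEquiv]
    · intro b _ hb
      refine Finset.sum_eq_zero fun t _ => ?_
      simp [Fin.snocEquiv, hb]
    · simp
  rw [key]
  split_ifs with hc ha
  · subst ha
    simp only [pathGF, Finset.mul_sum, ← Finset.sum_add_distrib]
    refine Finset.sum_congr rfl fun t _ => ?_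
    rw [isPath_snoc, peakSum_snoc]
    by_cases hp : IsPath (h - ((-1 : SignType) : ℤ)) t
    · rcases ht : t (Fin.last m) <;> simp_all [pow_add, mul_comm]
    · simp only [hp, and_false, false_and, if_false, mul_zero, add_zero]
  · simp only [pathGF, one_mul, ← Finset.sum_add_distrib]
    refine Finset.sum_congr rfl fun t _ => ?_
    rw [isPath_snoc, peakSum_snoc]
    by_cases hp : IsPath (h - (a : ℤ)) t
    · rcases ht : t (Fin.last m) <;> simp_all
    · simp [hp]
  · refine Finset.sum_eq_zero fun t _ => if_neg fun ht => hc ?_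
    rw [isPath_snoc] at ht
    exact ⟨ht.1, ht.2.1⟩

end Paths

section PathGF

open Polynomial

lemma pathHeight_one_zero (t : Fin 1 → SignType) :
    pathHeight t 0 = 0 ∧ pathHeight t 1 = t 0 := by
  simp [pathHeight]

lemma pathGF_zero_left (h : ℤ) (a : SignType) :
    pathGF 0 h a = if 0 ≤ h ∧ (a : ℤ) = h then 1 else 0 := by
  have key : ∀ t : Fin 1 → SignType, (IsPath h t ∧ t (Fin.last 0) = a) ↔
      t = (fun _ => a) ∧ (0 ≤ h ∧ (a : ℤ) = h) := by
    intro t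
    have e : t = (fun _ => a) ↔ t 0 = a := by
      rw [funext_iff, Fin.forall_fin_one]
    rw [e, IsPath]
    simp only [Fin.forall_fin_one, Fin.val_zero, zero_add, pathHeight_one_zero, Fin.last_zero]
    constructor
    · rintro ⟨⟨h1, -, h2⟩, rfl⟩
      exact ⟨rfl, by omega, h2⟩
    · rintro ⟨rfl, h1, h2⟩
      exact ⟨⟨by omega, fun _ => trivial, h2⟩, rfl⟩
  rw [pathGF]
  simp only [key, ite_and]
  rw [Finset.sum_ite_eq' Finset.univ (fun _ => a)]
  simp [peakSum]

lemma sum_pathGF_eq_qbinom {m h : ℕ} (hh : h ≤ m + 1)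
    (H : (pathGF m h 0 + pathGF m h 1 = qbinom m ((m + 1 - h) / 2)) ∧
      (∀ k, (m + 1 - h) / 2 = k + 1 → pathGF m h (-1) = X ^ (m - k) * qbinom m k) ∧
      ((m + 1 - h) / 2 = 0 → pathGF m h (-1) = 0)) :
    pathGF m h (-1) + pathGF m h 0 + pathGF m h 1 = qbinom (m + 1) ((m + 1 - h) / 2) := by
  obtain ⟨h1, h2, h3⟩ := H
  rcases hk : (m + 1 - h) / 2 with _ | k
  · rw [h3 hk, zero_add, h1, hk, qbinom_zero_right, qbinom_zero_right]
  · rw [add_assoc, h1, h2 k hk, hk, qbinom_succ_succ' (by omega), add_comm]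

lemma pathGF_eq (m h : ℕ) (hh : h ≤ m + 1) :
    (pathGF m h 0 + pathGF m h 1 = qbinom m ((m + 1 - h) / 2)) ∧
      (∀ k, (m + 1 - h) / 2 = k + 1 → pathGF m h (-1) = X ^ (m - k) * qbinom m k) ∧
      ((m + 1 - h) / 2 = 0 → pathGF m h (-1) = 0) := by
  induction m generalizing h with
  | zero =>
    have hk : (0 + 1 - h) / 2 = 0 := by omega
    simp only [pathGF_zero_left, hk]
    obtain rfl | rfl : h = 0 ∨ h = 1 := by omega
    all_goals simp [qbinom]
  | succ m ih =>
    refine ⟨?_, ?_⟩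
    · rcases h with _ | h
      · have t := sum_pathGF_eq_qbinom (by omega) (ih 0 (by omega))
        rw [pathGF_succ, pathGF_succ]
        rw [pathGF_eq_zero_of_neg m (h := ((0 : ℕ) : ℤ) - ((1 : SignType) : ℤ)) (by simp),
          pathGF_eq_zero_of_neg m (h := ((0 : ℕ) : ℤ) - ((1 : SignType) : ℤ)) (by simp),
          pathGF_eq_zero_of_neg m (h := ((0 : ℕ) : ℤ) - ((1 : SignType) : ℤ)) (by simp)]
        simp only [Nat.cast_zero, Nat.sub_zero] at t
        simp only [Nat.cast_zero, le_refl, implies_true, and_self, if_true, SignType.coe_zero,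
          sub_zero, add_zero, mul_zero, one_ne_zero]
        simp only [show ¬ ((0 : SignType) = -1) by decide, if_false, one_mul]
        simp only [Nat.sub_zero, t]
        rcases Nat.even_or_odd' m with ⟨c, rfl | rfl⟩
        · rw [show (2 * c + 1) / 2 = c by omega, show (2 * c + 1 + 1) / 2 = c + 1 by omega,
            show 2 * c + 1 = c + (c + 1) by omega]
          exact qbinom_symm c (c + 1)
        · rw [show (2 * c + 1 + 1) / 2 = c + 1 by omega,
            show (2 * c + 1 + 1 + 1) / 2 = c + 1 by omega]
      · have t := sum_pathGF_eq_qbinom (by omega) (ih h (by omega))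
        rw [pathGF_zero_of_pos _ (by omega), pathGF_succ]
        simp only [one_ne_zero, IsEmpty.forall_iff, and_true, SignType.coe_one, Nat.cast_add,
          Nat.cast_one, add_sub_cancel_right, show ¬ ((1 : SignType) = -1) by decide, if_false,
          one_mul]
        rw [if_pos (by omega), zero_add, t]
        congr 2
        omega
    · have e : pathGF (m + 1) h (-1) = pathGF m (h + 1 : ℕ) (-1) +
          X ^ (m + 1) * (pathGF m (h + 1 : ℕ) 0 + pathGF m (h + 1 : ℕ) 1) := by
        rw [pathGF_succ, pathGF_zero_of_pos m (h := (h + 1 : ℕ)) (by omega), 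
          if_pos ⟨by omega, fun h0 => absurd h0 (by decide)⟩, if_pos rfl]
        simp only [SignType.coe_neg_one, sub_neg_eq_add, Nat.cast_add, Nat.cast_one]
        rw [pathGF_zero_of_pos m (h := (h + 1 : ℤ)) (by omega)]
        ring
      refine ⟨fun k hk => ?_, fun hk => ?_⟩
      · obtain ⟨i1, i2, i3⟩ := ih (h + 1) (by omega)
        have hk' : (m + 1 - (h + 1)) / 2 = k := by omega
        rw [e, i1, hk']
        rcases k with _ | k
        · rw [i3 hk', qbinom_zero_right, qbinom_zero_right]; simp
        · rw [i2 k hk', qbinom_succ_succ]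
          obtain ⟨d, rfl⟩ : ∃ d, m = k + 1 + d := ⟨m - (k + 1), by omega⟩
          rw [show k + 1 + d - k = d + 1 by omega, show k + 1 + d + 1 - (k + 1) = d + 1 by omega]
          ring
      · rw [e]
        by_cases hm : h + 1 ≤ m + 1
        · obtain ⟨i1, i2, i3⟩ := ih (h + 1) (by omega)
          omega
        · have hlt : ((m : ℤ) + 1) < ((h + 1 : ℕ) : ℤ) := by omega
          rw [pathGF_eq_zero_of_lt m hlt, pathGF_eq_zero_of_lt m hlt, pathGF_eq_zero_of_lt m hlt]
          simp

/-- The distribution of the peak sum over the paths that end at height zero. -/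
lemma sum_isPath_zero (m : ℕ) [DecidablePred fun t : Fin (m + 1) → SignType => IsPath 0 t] :
    ∑ t : Fin (m + 1) → SignType with IsPath 0 t, (X : ℤ[X]) ^ peakSum t =
      qbinom (m + 1) ((m + 1) / 2) := by
  have h := sum_pathGF_eq_qbinom (m := m) (h := 0) (by omega) (pathGF_eq m 0 (by omega))
  rw [Nat.cast_zero, Nat.sub_zero] at h
  rw [← h]
  simp only [pathGF, ← Finset.sum_add_distrib, Finset.sum_filter]
  refine Finset.sum_congr rfl fun t _ => ?_
  by_cases ht : IsPath 0 t
  · cases t (Fin.last m) <;> simp [ht]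
  · simp [ht]

end PathGF

section Permutations

open Equiv

variable {m : ℕ}

/-- The adjacent transposition exchanging `i` and `i + 1`. -/
def adjSwap (i : Fin m) : Perm (Fin (m + 1)) := swap i.castSucc i.succ

lemma adjSwap_apply (i : Fin m) (a : Fin (m + 1)) :
    adjSwap i a = if (a : ℕ) = i then i.succ else if (a : ℕ) = i + 1 then i.castSucc else a := by
  simp [adjSwap, swap_apply_def, Fin.ext_iff]

lemma adjSwap_val (i : Fin m) (a : Fin (m + 1)) :
    (adjSwap i a : ℕ) = if (a : ℕ) = i then (i : ℕ) + 1 else if (a : ℕ) = (i : ℕ) + 1 then (i : ℕ) else a := by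
  rw [adjSwap_apply]; split_ifs <;> simp

@[simp] lemma adjSwap_castSucc (i : Fin m) : adjSwap i i.castSucc = i.succ := swap_apply_left _ _

@[simp] lemma adjSwap_succ (i : Fin m) : adjSwap i i.succ = i.castSucc := swap_apply_right _ _

lemma adjSwap_mul_self (i : Fin m) : adjSwap i * adjSwap i = 1 := swap_mul_self _ _

lemma adjSwap_adjSwap (i : Fin m) (a : Fin (m + 1)) : adjSwap i (adjSwap i a) = a :=
  Equiv.congr_fun (adjSwap_mul_self i) a

lemma adjSwap_lt {i : Fin m} {a b : Fin (m + 1)} (h : a < b)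
    (hab : ¬ ((a : ℕ) = i ∧ (b : ℕ) = i + 1)) : adjSwap i a < adjSwap i b := by
  rw [Fin.lt_def] at *
  rw [adjSwap_val, adjSwap_val]
  split_ifs <;> omega

/-- The set of inversions of a permutation. -/
def inversions (σ : Perm (Fin (m + 1))) : Finset (Fin (m + 1) × Fin (m + 1)) :=
  Finset.univ.filter fun p => p.1 < p.2 ∧ σ p.2 < σ p.1

lemma mem_inversions {σ : Perm (Fin (m + 1))} {p : Fin (m + 1) × Fin (m + 1)} :
    p ∈ inversions σ ↔ p.1 < p.2 ∧ σ p.2 < σ p.1 := by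
  simp [inversions]

lemma inversions_mul_adjSwap {σ : Perm (Fin (m + 1))} {i : Fin m}
    (h : σ i.castSucc < σ i.succ) :
    inversions (σ * adjSwap i) = insert (i.castSucc, i.succ)
      ((inversions σ).map ((adjSwap i).prodCongr (adjSwap i)).toEmbedding) := by
  ext ⟨a, b⟩
  rw [Finset.mem_insert, Finset.mem_map_equiv]
  have hs : (adjSwap i).symm = adjSwap i := symm_swap _ _
  simp only [mem_inversions, Perm.mul_apply,
    Prod.mk.injEq, prodCongr_symm, hs, prodCongr_apply, Prod.map_apply]
  constructor
  · rintro ⟨h1, h2⟩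
    by_cases hab : (a : ℕ) = i ∧ (b : ℕ) = i + 1
    · exact Or.inl ⟨Fin.ext hab.1, Fin.ext hab.2⟩
    · exact Or.inr ⟨adjSwap_lt h1 hab, h2⟩
  · rintro (⟨rfl, rfl⟩ | ⟨h1, h2⟩)
    · simpa using h
    · refine ⟨?_, h2⟩
      by_cases hab : (adjSwap i a : ℕ) = i ∧ (adjSwap i b : ℕ) = i + 1
      · have ha : adjSwap i a = i.castSucc := Fin.ext hab.1
        have hb : adjSwap i b = i.succ := Fin.ext hab.2
        rw [ha, hb] at h2
        exact absurd h2 h.not_gt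
      · simpa only [adjSwap_adjSwap] using adjSwap_lt h1 hab

lemma card_inversions_mul_adjSwap_of_lt {σ : Perm (Fin (m + 1))} {i : Fin m}
    (h : σ i.castSucc < σ i.succ) :
    (inversions (σ * adjSwap i)).card = (inversions σ).card + 1 := by
  rw [inversions_mul_adjSwap h, Finset.card_insert_of_notMem, Finset.card_map]
  rw [Finset.mem_map_equiv]
  have hs : (adjSwap i).symm = adjSwap i := symm_swap _ _
  simp [inversions, hs, (Fin.castSucc_lt_succ (i := i)).le]

lemma card_inversions_mul_adjSwap_of_gt {σ : Perm (Fin (m + 1))} {i : Fin m}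
    (h : σ i.succ < σ i.castSucc) :
    (inversions (σ * adjSwap i)).card + 1 = (inversions σ).card := by
  have := card_inversions_mul_adjSwap_of_lt (σ := σ * adjSwap i) (i := i) (by simpa using h)
  rw [mul_assoc, adjSwap_mul_self, mul_one] at this
  exact this.symm

lemma apply_castSucc_lt_or_gt (σ : Perm (Fin (m + 1))) (i : Fin m) :
    σ i.castSucc < σ i.succ ∨ σ i.succ < σ i.castSucc :=
  lt_or_gt_of_ne fun h => absurd (σ.injective h) (Fin.castSucc_lt_succ (i := i)).ne

lemma typeA_apply (i j : Fin m) : typeA m i j = if (i : ℕ) = (j : ℕ) then 1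
    else if (i : ℕ) + 1 = (j : ℕ) ∨ (j : ℕ) + 1 = (i : ℕ) then 3 else 2 := rfl

lemma isLiftable_adjSwap : (typeA m).IsLiftable (adjSwap (m := m)) := by
  intro i j
  rw [typeA_apply]
  split_ifs with h1 h2
  · rw [Fin.ext h1, adjSwap_mul_self, one_pow]
  · ext a
    simp only [pow_succ, pow_zero, one_mul, Perm.mul_apply, Perm.one_apply]
    grind (splits := 25) [adjSwap_val]
  · ext a
    simp only [pow_succ, pow_zero, one_mul, Perm.mul_apply, Perm.one_apply]
    grind [adjSwap_val]

/-- The action of the Coxeter group of type `A_m` as permutations of `m + 1` points. -/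
def toPerm (m : ℕ) : (typeA m).Group →* Perm (Fin (m + 1)) :=
  (typeA m).toCoxeterSystem.lift ⟨adjSwap, isLiftable_adjSwap⟩

local notation "cs" => CoxeterMatrix.toCoxeterSystem (typeA m)

lemma toPerm_simple (i : Fin m) : toPerm m ((cs).simple i) = adjSwap i :=
  (cs).lift_apply_simple isLiftable_adjSwap i

lemma braid_of_pow_three {G : Type*} [Group G] {a b : G} (ha : a * a = 1) (hb : b * b = 1)
    (h : (a * b) ^ 3 = 1) : a * b * a = b * a * b := by
  have h' : (a * b * a) * (b * a * b) = 1 := by rw [← h]; simp only [pow_succ, pow_zero]; group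
  rw [eq_comm, ← inv_eq_of_mul_eq_one_right h', mul_inv_rev, mul_inv_rev,
    inv_eq_of_mul_eq_one_right ha, inv_eq_of_mul_eq_one_right hb, mul_assoc]

lemma comm_of_pow_two {G : Type*} [Group G] {a b : G} (ha : a * a = 1) (hb : b * b = 1)
    (h : (a * b) ^ 2 = 1) : a * b = b * a := by
  rw [pow_two] at h
  rw [← inv_eq_of_mul_eq_one_right h, mul_inv_rev,
    inv_eq_of_mul_eq_one_right ha, inv_eq_of_mul_eq_one_right hb]

lemma simple_braid {i j : Fin m} (h : (i : ℕ) + 1 = j ∨ (j : ℕ) + 1 = i) :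
    (cs).simple i * (cs).simple j * (cs).simple i =
      (cs).simple j * (cs).simple i * (cs).simple j := by
  refine braid_of_pow_three ((cs).simple_mul_simple_self i) ((cs).simple_mul_simple_self j) ?_
  have := (cs).simple_mul_simple_pow i j
  rwa [typeA_apply, if_neg (by omega), if_pos h] at this

lemma simple_comm {i j : Fin m} (h : (i : ℕ) + 1 < j ∨ (j : ℕ) + 1 < i) :
    (cs).simple i * (cs).simple j = (cs).simple j * (cs).simple i := by
  refine comm_of_pow_two ((cs).simple_mul_simple_self i) ((cs).simple_mul_simple_self j) ?_
  have := (cs).simple_mul_simple_pow i j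
  rwa [typeA_apply, if_neg (by omega), if_neg (by omega)] at this

lemma adjSwap_braid {i j : Fin m} (h : (i : ℕ) + 1 = j ∨ (j : ℕ) + 1 = i) :
    adjSwap i * adjSwap j * adjSwap i = adjSwap j * adjSwap i * adjSwap j := by
  simpa only [map_mul, toPerm_simple] using congrArg (toPerm m) (simple_braid h)

lemma adjSwap_comm {i j : Fin m} (h : (i : ℕ) + 1 < j ∨ (j : ℕ) + 1 < i) :
    adjSwap i * adjSwap j = adjSwap j * adjSwap i := by
  simpa only [map_mul, toPerm_simple] using congrArg (toPerm m) (simple_comm h)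

open Classical in
/-- The group element obtained by bubble sorting a permutation. -/
noncomputable def ofPerm (σ : Perm (Fin (m + 1))) : (typeA m).Group :=
  if h : ∃ i : Fin m, σ i.succ < σ i.castSucc then
    ofPerm (σ * adjSwap h.choose) * (cs).simple h.choose
  else 1
termination_by (inversions σ).card
decreasing_by
  have := card_inversions_mul_adjSwap_of_gt h.choose_spec
  omega

lemma adjSwap_castSucc_of_far {i j : Fin m} (h : (i : ℕ) + 1 < j ∨ (j : ℕ) + 1 < i) :
    adjSwap i j.castSucc = j.castSucc := by
  ext; rw [adjSwap_val]; simp only [Fin.val_castSucc]; split_ifs <;> omega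

lemma adjSwap_succ_of_far {i j : Fin m} (h : (i : ℕ) + 1 < j ∨ (j : ℕ) + 1 < i) :
    adjSwap i j.succ = j.succ := by
  ext; rw [adjSwap_val]; simp only [Fin.val_succ]; split_ifs <;> omega

lemma far_descent {σ : Perm (Fin (m + 1))} {i j : Fin m}
    (h : (i : ℕ) + 1 < j ∨ (j : ℕ) + 1 < i) (hj : σ j.succ < σ j.castSucc) :
    (σ * adjSwap i) j.succ < (σ * adjSwap i) j.castSucc := by
  simpa [adjSwap_castSucc_of_far h, adjSwap_succ_of_far h] using hj

lemma near_descents {σ : Perm (Fin (m + 1))} {i j : Fin m}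
    (h : (i : ℕ) + 1 = j ∨ (j : ℕ) + 1 = i) (hi : σ i.succ < σ i.castSucc)
    (hj : σ j.succ < σ j.castSucc) :
    (σ * adjSwap i) j.succ < (σ * adjSwap i) j.castSucc ∧
      (σ * adjSwap i * adjSwap j) i.succ < (σ * adjSwap i * adjSwap j) i.castSucc := by
  simp only [Perm.mul_apply]
  rcases h with h | h
  · have e : j.castSucc = i.succ := Fin.ext (by simp [h])
    have e1 : adjSwap i j.succ = j.succ := by
      ext; rw [adjSwap_val]; simp only [Fin.val_succ]; split_ifs <;> omega
    have e2 : adjSwap j i.castSucc = i.castSucc := by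
      ext; rw [adjSwap_val]; simp only [Fin.val_castSucc]; split_ifs <;> omega
    have e3 : adjSwap j i.succ = j.succ := by rw [← e, adjSwap_castSucc]
    rw [e1, e2, e3, e1, e, adjSwap_succ, adjSwap_castSucc]
    rw [e] at hj
    exact ⟨hj.trans hi, hj⟩
  · have e : i.castSucc = j.succ := Fin.ext (by simp [h])
    have e1 : adjSwap i j.castSucc = j.castSucc := by
      ext; rw [adjSwap_val]; simp only [Fin.val_castSucc]; split_ifs <;> omega
    have e2 : adjSwap j i.succ = i.succ := by
      ext; rw [adjSwap_val]; simp only [Fin.val_succ]; split_ifs <;> omega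
    have e3 : adjSwap j i.castSucc = j.castSucc := by rw [e, adjSwap_succ]
    rw [e1, e2, e3, e1, ← e, adjSwap_succ, adjSwap_castSucc]
    rw [← e] at hj
    exact ⟨hi.trans hj, hj⟩

lemma ofPerm_of_descent (σ : Perm (Fin (m + 1))) (i : Fin m) (hi : σ i.succ < σ i.castSucc) :
    ofPerm σ = ofPerm (σ * adjSwap i) * (cs).simple i := by
  induction hN : (inversions σ).card using Nat.strong_induction_on generalizing σ i with
  | _ N ih =>
    have hex : ∃ i : Fin m, σ i.succ < σ i.castSucc := ⟨i, hi⟩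
    rw [ofPerm, dif_pos hex]
    generalize hex.choose = j, hex.choose_spec = hj
    have ci := card_inversions_mul_adjSwap_of_gt hi
    have cj := card_inversions_mul_adjSwap_of_gt hj
    rcases eq_or_ne i j with rfl | hij
    · rfl
    have hij' : (i : ℕ) ≠ j := fun h => hij (Fin.ext h)
    by_cases hn : (i : ℕ) + 1 = j ∨ (j : ℕ) + 1 = i
    · obtain ⟨a1, a2⟩ := near_descents hn hi hj
      obtain ⟨b1, b2⟩ := near_descents hn.symm hj hi
      have c1 := card_inversions_mul_adjSwap_of_gt a1
      have c2 := card_inversions_mul_adjSwap_of_gt b1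
      rw [ih _ (by omega) _ _ a1 rfl, ih _ (by omega) _ _ a2 rfl,
        ih _ (by omega) _ _ b1 rfl, ih _ (by omega) _ _ b2 rfl]
      have p := adjSwap_braid hn
      have s := simple_braid hn
      simp only [mul_assoc] at p s ⊢
      rw [p, s]
    · have hf : (i : ℕ) + 1 < j ∨ (j : ℕ) + 1 < i := by omega
      rw [ih _ (by omega) _ _ (far_descent hf hj) rfl,
        ih _ (by omega) _ _ (far_descent hf.symm hi) rfl, mul_assoc, mul_assoc,
        mul_assoc, mul_assoc, adjSwap_comm hf, simple_comm hf]

lemma ofPerm_mul_adjSwap (σ : Perm (Fin (m + 1))) (i : Fin m) :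
    ofPerm (σ * adjSwap i) = ofPerm σ * (cs).simple i := by
  rcases apply_castSucc_lt_or_gt σ i with h | h
  · rw [ofPerm_of_descent (σ * adjSwap i) i (by simpa using h), mul_assoc σ, adjSwap_mul_self,
      mul_one]
  · rw [ofPerm_of_descent σ i h, CoxeterSystem.simple_mul_simple_cancel_right]

lemma ofPerm_toPerm (w : (typeA m).Group) : ofPerm (toPerm m w) = w := by
  refine (cs).simple_induction_right (p := fun w => ofPerm (toPerm m w) = w) w ?_ fun w i hw => ?_
  · rw [map_one, ofPerm, dif_neg]
    rintro ⟨i, hi⟩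
    exact hi.not_ge (Fin.castSucc_lt_succ (i := i)).le
  · rw [map_mul, toPerm_simple, ofPerm_mul_adjSwap, hw]

lemma toPerm_injective : Function.Injective (toPerm m) :=
  Function.LeftInverse.injective ofPerm_toPerm

lemma toPerm_surjective : Function.Surjective (toPerm m) := by
  rw [← MonoidHom.mrange_eq_top, eq_top_iff, ← Perm.mclosure_swap_castSucc_succ, Submonoid.closure_le]
  rintro _ ⟨i, rfl⟩
  exact ⟨_, toPerm_simple i⟩

lemma length_ofPerm_le (σ : Perm (Fin (m + 1))) :
    (cs).length (ofPerm σ) ≤ (inversions σ).card := by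
  induction hN : (inversions σ).card using Nat.strong_induction_on generalizing σ with
  | _ N ih =>
    rw [ofPerm]
    split_ifs with h
    · have c := card_inversions_mul_adjSwap_of_gt h.choose_spec
      have := ih _ (by omega) (σ * adjSwap h.choose) rfl
      have := (cs).length_mul_le (ofPerm (σ * adjSwap h.choose)) ((cs).simple h.choose)
      rw [CoxeterSystem.length_simple] at this
      omega
    · simp

lemma card_inversions_wordProd_le (u : List (Fin m)) :
    (inversions (toPerm m ((cs).wordProd u))).card ≤ u.length := by
  induction u using List.reverseRecOn with
  | nil =>
    simp only [CoxeterSystem.wordProd_nil, map_one, List.length_nil, Nat.le_zero,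
      Finset.card_eq_zero]
    ext p
    simpa [mem_inversions] using fun h : p.1 < p.2 => le_of_lt h
  | append_singleton u i ih =>
    rw [CoxeterSystem.wordProd_append, CoxeterSystem.wordProd_singleton, map_mul, toPerm_simple,
      List.length_append, List.length_singleton]
    rcases apply_castSucc_lt_or_gt (toPerm m ((cs).wordProd u)) i with h | h
    · rw [card_inversions_mul_adjSwap_of_lt h]; omega
    · have := card_inversions_mul_adjSwap_of_gt h; omega

lemma length_eq_card_inversions (w : (typeA m).Group) :
    (cs).length w = (inversions (toPerm m w)).card := by
  apply le_antisymm
  · simpa only [ofPerm_toPerm] using length_ofPerm_le (toPerm m w)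
  · obtain ⟨u, hu, rfl⟩ := (cs).exists_isReduced w
    rw [hu.eq]
    exact card_inversions_wordProd_le u

lemma length_mul_simple_lt_iff (w : (typeA m).Group) (i : Fin m) :
    (cs).length (w * (cs).simple i) < (cs).length w ↔
      toPerm m w i.succ < toPerm m w i.castSucc := by
  rw [length_eq_card_inversions, length_eq_card_inversions, map_mul, toPerm_simple]
  rcases apply_castSucc_lt_or_gt (toPerm m w) i with h | h
  · simp [card_inversions_mul_adjSwap_of_lt h, h.le]
  · have := card_inversions_mul_adjSwap_of_gt h
    simp only [h, iff_true]
    omega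

/-- A permutation contains the pattern 321. -/
def Contains321 (σ : Perm (Fin (m + 1))) : Prop :=
  ∃ a b c : Fin (m + 1), a < b ∧ b < c ∧ σ c < σ b ∧ σ b < σ a

lemma contains321_of_adjacent_descents {σ : Perm (Fin (m + 1))} {i j : Fin m}
    (h : (i : ℕ) + 1 = j) (hi : σ i.succ < σ i.castSucc) (hj : σ j.succ < σ j.castSucc) :
    Contains321 σ := by
  have e : j.castSucc = i.succ := Fin.ext (by simp [h])
  rw [e] at hj
  exact ⟨_, _, _, Fin.castSucc_lt_succ, e ▸ Fin.castSucc_lt_succ, hj, hi⟩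

lemma Contains321.of_mul_adjSwap {σ : Perm (Fin (m + 1))} {i : Fin m}
    (hi : σ i.succ < σ i.castSucc) (h : Contains321 (σ * adjSwap i)) : Contains321 σ := by
  obtain ⟨a, b, c, hab, hbc, h1, h2⟩ := h
  have key : ∀ {x y : Fin (m + 1)}, x < y → (σ * adjSwap i) y < (σ * adjSwap i) x →
      adjSwap i x < adjSwap i y := by
    intro x y hxy hσ
    refine adjSwap_lt hxy fun hxy' => ?_
    obtain rfl : x = i.castSucc := Fin.ext hxy'.1
    obtain rfl : y = i.succ := Fin.ext hxy'.2
    simp only [Perm.mul_apply, adjSwap_castSucc, adjSwap_succ] at hσ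
    exact hσ.not_gt hi
  exact ⟨_, _, _, key hab h2, key hbc h1, h1, h2⟩

lemma commEquiv_append_right {B : Type*} {M : CoxeterMatrix B} {u v : List B}
    (h : CommEquiv M u v) (x : List B) : CommEquiv M (u ++ x) (v ++ x) := by
  induction h with
  | rel _ _ h =>
    obtain ⟨p, q, a, b, hab, rfl, rfl⟩ := h
    exact .rel _ _ ⟨p, q ++ x, a, b, hab, by simp, by simp⟩
  | refl => exact .refl _
  | symm _ _ _ ih => exact .symm _ _ ih
  | trans _ _ _ _ _ ih1 ih2 => exact .trans _ _ _ ih1 ih2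

lemma CommEquiv.perm {B : Type*} {M : CoxeterMatrix B} {u v : List B}
    (h : CommEquiv M u v) : u.Perm v := by
  induction h with
  | rel _ _ h =>
    obtain ⟨p, q, a, b, hab, rfl, rfl⟩ := h
    exact (List.Perm.swap _ _ _).append_left p
  | refl => exact .refl _
  | symm _ _ _ ih => exact ih.symm
  | trans _ _ _ _ _ ih1 ih2 => exact ih1.trans ih2

lemma isReduced_append_singleton {w : (typeA m).Group} {i : Fin m} {x : List (Fin m)}
    (h : (cs).length (w * (cs).simple i) < (cs).length w) (hx : (cs).IsReduced x)
    (hxw : (cs).wordProd x = w * (cs).simple i) :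
    (cs).IsReduced (x ++ [i]) ∧ (cs).wordProd (x ++ [i]) = w := by
  have e : (cs).wordProd (x ++ [i]) = w := by
    rw [CoxeterSystem.wordProd_append, CoxeterSystem.wordProd_singleton, hxw,
      CoxeterSystem.simple_mul_simple_cancel_right]
  refine ⟨?_, e⟩
  have h1 := hx.eq
  rw [hxw] at h1
  rw [CoxeterSystem.IsReduced, e, List.length_append, List.length_singleton]
  have := (cs).length_mul_simple w i
  omega

lemma isReduced_of_append_singleton {i : Fin m} {x : List (Fin m)}
    (hx : (cs).IsReduced (x ++ [i])) :
    (cs).IsReduced x ∧ (cs).wordProd x = (cs).wordProd (x ++ [i]) * (cs).simple i ∧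
      (cs).length ((cs).wordProd (x ++ [i]) * (cs).simple i) <
        (cs).length ((cs).wordProd (x ++ [i])) := by
  have e : (cs).wordProd x = (cs).wordProd (x ++ [i]) * (cs).simple i := by
    rw [CoxeterSystem.wordProd_append, CoxeterSystem.wordProd_singleton,
      CoxeterSystem.simple_mul_simple_cancel_right]
  have hr : (cs).IsReduced x := by simpa using hx.take x.length
  refine ⟨hr, e, ?_⟩
  rw [← e, hr.eq, hx.eq]
  simp

lemma isFullyCommutative_of_not_contains321 (w : (typeA m).Group)
    (hw : ¬ Contains321 (toPerm m w)) : IsFullyCommutative (cs) w := by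
  induction hN : (cs).length w using Nat.strong_induction_on generalizing w with
  | _ N ih =>
    intro u v hu huw hv hvw
    rcases List.eq_nil_or_concat u with rfl | ⟨u, i, rfl⟩
    · have h0 := hv.eq
      rw [hvw, ← huw] at h0
      simp only [CoxeterSystem.wordProd_nil, CoxeterSystem.length_one] at h0
      rw [List.eq_nil_of_length_eq_zero h0.symm]
      exact .refl _
    rcases List.eq_nil_or_concat v with rfl | ⟨v, j, rfl⟩
    · have h0 := hu.eq
      rw [huw, ← hvw] at h0
      simp at h0
    rw [List.concat_eq_append] at hu huw hv hvw
    rw [List.concat_eq_append, List.concat_eq_append]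
    obtain ⟨hu1, hu2, hu3⟩ := isReduced_of_append_singleton hu
    obtain ⟨hv1, hv2, hv3⟩ := isReduced_of_append_singleton hv
    rw [huw] at hu2 hu3
    rw [hvw] at hv2 hv3
    have hi := (length_mul_simple_lt_iff w i).1 hu3
    have hj := (length_mul_simple_lt_iff w j).1 hv3
    have avoid : ∀ {w : (typeA m).Group} {i : Fin m}, toPerm m w i.succ < toPerm m w i.castSucc →
        ¬ Contains321 (toPerm m w) → ¬ Contains321 (toPerm m (w * (cs).simple i)) := by
      intro w i h1 h2 h3
      rw [map_mul, toPerm_simple] at h3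
      exact h2 (h3.of_mul_adjSwap h1)
    have ci := ih _ (by omega) _ (avoid hi hw) rfl
    have cj := ih _ (by omega) _ (avoid hj hw) rfl
    rcases eq_or_ne i j with rfl | hij
    · exact commEquiv_append_right (ci u v hu1 hu2 hv1 hv2) _
    have hij' : (i : ℕ) ≠ j := fun h => hij (Fin.ext h)
    by_cases hn : (i : ℕ) + 1 = j ∨ (j : ℕ) + 1 = i
    · exfalso
      rcases hn with hn | hn
      · exact hw (contains321_of_adjacent_descents hn hi hj)
      · exact hw (contains321_of_adjacent_descents hn hj hi)
    have hf : (i : ℕ) + 1 < j ∨ (j : ℕ) + 1 < i := by omega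
    have dij := far_descent hf hj
    have dji := far_descent hf.symm hi
    rw [← toPerm_simple, ← map_mul, ← length_mul_simple_lt_iff] at dij dji
    obtain ⟨x, hx, hxw⟩ := (cs).exists_isReduced (w * (cs).simple i * (cs).simple j)
    have hxw' : (cs).wordProd x = w * (cs).simple j * (cs).simple i := by
      rw [← hxw, mul_assoc, mul_assoc, simple_comm hf]
    obtain ⟨r1, p1⟩ := isReduced_append_singleton dij hx hxw.symm
    obtain ⟨r2, p2⟩ := isReduced_append_singleton dji hx hxw'
    refine .trans _ _ _ (commEquiv_append_right (ci u (x ++ [j]) hu1 hu2 r1 p1) [i]) ?_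
    refine .trans _ _ _ ?_ (commEquiv_append_right (cj (x ++ [i]) v r2 p2 hv1 hv2) [j])
    refine .rel _ _ ⟨x, [], j, i, ?_, by simp, by simp⟩
    rw [typeA_apply, if_neg (by omega), if_neg (by omega)]

/-- A permutation containing 321 has two consecutive descents, or remains so after
sorting some descent. -/
lemma Contains321.exists_descent {σ : Perm (Fin (m + 1))} (h : Contains321 σ) :
    (∃ i j : Fin m, (i : ℕ) + 1 = j ∧ σ i.succ < σ i.castSucc ∧ σ j.succ < σ j.castSucc) ∨
      ∃ i : Fin m, σ i.succ < σ i.castSucc ∧ Contains321 (σ * adjSwap i) := by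
  obtain ⟨a, b, c, hab, hbc, h1, h2⟩ := h
  induction hN : (c : ℕ) - a using Nat.strong_induction_on generalizing a b c with
  | _ N ih =>
    rw [Fin.lt_def] at hab hbc
    have hc := c.isLt
    by_cases hb : (a : ℕ) + 1 = b
    · by_cases hb' : (b : ℕ) + 1 = c
      · left
        refine ⟨⟨a, by omega⟩, ⟨b, by omega⟩, hb, ?_, ?_⟩
        · convert h2 using 2
          · exact Fin.ext hb
          · rfl
        · convert h1 using 2
          · exact Fin.ext hb'
          · rfl
      · set i : Fin m := ⟨c - 1, by omega⟩ with hi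
        have ec : i.succ = c := Fin.ext (by simp [hi]; omega)
        have hbi : b < i.castSucc := by rw [Fin.lt_def]; simp [hi]; omega
        rcases lt_or_gt_of_ne (σ.injective.ne hbi.ne) with hlt | hgt
        · right
          refine ⟨i, ?_, a, b, i.castSucc, hab, hbi, ?_, ?_⟩
          · rw [ec]; exact h1.trans hlt
          all_goals
            have ea : adjSwap i a = a := by
              ext; rw [adjSwap_val, hi]; simp only; split_ifs <;> omega
            have eb : adjSwap i b = b := by
              ext; rw [adjSwap_val, hi]; simp only; split_ifs <;> omega
            simp only [Perm.mul_apply, adjSwap_castSucc, ea, eb, ec]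
            assumption
        · refine ih _ ?_ a b i.castSucc hab hbi hgt h2 rfl
          simp [hi]; omega
    · set i : Fin m := ⟨a, by omega⟩ with hi
      have ea : i.castSucc = a := rfl
      have hib : i.succ < b := by rw [Fin.lt_def]; simp [hi]; omega
      rcases lt_or_gt_of_ne (σ.injective.ne hib.ne) with hlt | hgt
      · right
        refine ⟨i, ?_, i.succ, b, c, hib, hbc, ?_, ?_⟩
        · rw [ea]; exact hlt.trans h2
        all_goals
          have eb : adjSwap i b = b := by
            ext; rw [adjSwap_val, hi]; simp only; split_ifs <;> omega
          have ec : adjSwap i c = c := by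
            ext; rw [adjSwap_val, hi]; simp only; split_ifs <;> omega
          simp only [Perm.mul_apply, adjSwap_succ, ea, eb, ec]
          assumption
      · refine ih _ ?_ i.succ b c hib hbc h1 hgt rfl
        simp [hi]; omega

lemma exists_isReduced_not_perm (w : (typeA m).Group) (hw : Contains321 (toPerm m w)) :
    ∃ u v, (cs).IsReduced u ∧ (cs).wordProd u = w ∧ (cs).IsReduced v ∧ (cs).wordProd v = w ∧
      ¬ u.Perm v := by
  induction hN : (cs).length w using Nat.strong_induction_on generalizing w with
  | _ N ih =>
    rcases hw.exists_descent with ⟨i, j, hij, hi, hj⟩ | ⟨i, hi, h⟩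
    · have hn : (i : ℕ) + 1 = j ∨ (j : ℕ) + 1 = i := Or.inl hij
      obtain ⟨a1, a2⟩ := near_descents hn hi hj
      obtain ⟨b1, b2⟩ := near_descents hn.symm hj hi
      simp only [← toPerm_simple, ← map_mul] at a1 a2 b1 b2
      rw [← length_mul_simple_lt_iff] at a1 a2 b1 b2 hi hj
      obtain ⟨x, hx, hxw⟩ := (cs).exists_isReduced
        (w * (cs).simple i * (cs).simple j * (cs).simple i)
      have hxw' : (cs).wordProd x = w * (cs).simple j * (cs).simple i * (cs).simple j := by
        have s := simple_braid hn
        simp only [mul_assoc] at s hxw ⊢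
        rw [← hxw, s]
      obtain ⟨r1, p1⟩ := isReduced_append_singleton a2 hx hxw.symm
      obtain ⟨r2, p2⟩ := isReduced_append_singleton a1 r1 p1
      obtain ⟨r3, p3⟩ := isReduced_append_singleton hi r2 p2
      obtain ⟨s1, q1⟩ := isReduced_append_singleton b2 hx hxw'
      obtain ⟨s2, q2⟩ := isReduced_append_singleton b1 s1 q1
      obtain ⟨s3, q3⟩ := isReduced_append_singleton hj s2 q2
      refine ⟨_, _, r3, p3, s3, q3, fun hp => ?_⟩
      have hne : j ≠ i := by rintro rfl; omega
      have := hp.count_eq i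
      simp [hne] at this
    · rw [← toPerm_simple, ← map_mul] at h
      rw [← length_mul_simple_lt_iff] at hi
      obtain ⟨u, v, hu, hu', hv, hv', hp⟩ := ih _ (by omega) _ h rfl
      obtain ⟨r1, p1⟩ := isReduced_append_singleton hi hu hu'
      obtain ⟨r2, p2⟩ := isReduced_append_singleton hi hv hv'
      exact ⟨_, _, r1, p1, r2, p2, fun h' => hp ((List.perm_append_right_iff _).1 h')⟩

lemma isFullyCommutative_iff (w : (typeA m).Group) :
    IsFullyCommutative (cs) w ↔ ¬ Contains321 (toPerm m w) := by
  refine ⟨fun h h' => ?_, isFullyCommutative_of_not_contains321 w⟩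
  obtain ⟨u, v, hu, hu', hv, hv', hp⟩ := exists_isReduced_not_perm w h'
  exact hp (h u v hu hu' hv hv').perm

end Permutations

section Bijection

open Equiv

variable {m : ℕ}

/-- The set of the indices below `i` of the steps equal to `a`. -/
def stepsBelow {n : ℕ} (t : Fin n → SignType) (a : SignType) (i : ℕ) : Finset (Fin n) :=
  Finset.univ.filter fun j => (j : ℕ) < i ∧ t j = a

lemma mem_stepsBelow {n : ℕ} {t : Fin n → SignType} {a : SignType} {i : ℕ} {j : Fin n} :
    j ∈ stepsBelow t a i ↔ (j : ℕ) < i ∧ t j = a := by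
  simp [stepsBelow]

lemma pathHeight_eq_card_sub_card {n : ℕ} (t : Fin n → SignType) (i : ℕ) :
    pathHeight t i = ((stepsBelow t 1 i).card : ℤ) - (stepsBelow t (-1) i).card := by
  simp only [pathHeight, stepsBelow, Finset.card_filter, Nat.cast_sum, ← Finset.sum_sub_distrib]
  refine Finset.sum_congr rfl fun j _ => ?_
  by_cases hj : (j : ℕ) < i
  · cases t j <;> simp [hj]
  · simp [hj]

/-- The path that steps up at `i` if `i < σ i`, down if `σ i < i`, and is horizontal at the fixed
points of `σ`. -/
noncomputable def stepWord (σ : Perm (Fin (m + 1))) (i : Fin (m + 1)) : SignType :=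
  SignType.sign (((σ i : ℕ) : ℤ) - (i : ℕ))

lemma stepWord_eq_one {σ : Perm (Fin (m + 1))} {i : Fin (m + 1)} :
    stepWord σ i = 1 ↔ i < σ i := by
  rw [stepWord, sign_eq_one_iff, Fin.lt_def]; omega

lemma stepWord_eq_neg_one {σ : Perm (Fin (m + 1))} {i : Fin (m + 1)} :
    stepWord σ i = -1 ↔ σ i < i := by
  rw [stepWord, sign_eq_neg_one_iff, Fin.lt_def]; omega

lemma stepWord_eq_zero {σ : Perm (Fin (m + 1))} {i : Fin (m + 1)} :
    stepWord σ i = 0 ↔ σ i = i := by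
  rw [stepWord, sign_eq_zero_iff, Fin.ext_iff]; omega

lemma SignType.eq_one_or_eq_neg_one_or_eq_zero (a : SignType) : a = 1 ∨ a = -1 ∨ a = 0 := by
  cases a <;> simp

lemma isPath_stepWord {σ : Perm (Fin (m + 1))} (hσ : Function.Involutive σ)
    (h : ¬ Contains321 σ) : IsPath 0 (stepWord σ) := by
  have le : ∀ i, (stepsBelow (stepWord σ) (-1) i).card ≤ (stepsBelow (stepWord σ) 1 i).card := by
    intro i
    refine Finset.card_le_card_of_injOn σ (fun x hx => ?_) σ.injective.injOn
    simp only [Finset.mem_coe, mem_stepsBelow, stepWord_eq_one, stepWord_eq_neg_one, hσ x] at hx ⊢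
    exact ⟨lt_trans (Fin.lt_def.1 hx.2) hx.1, hx.2⟩
  have ge : ∀ i : ℕ, (∀ x : Fin (m + 1), (x : ℕ) < i → x < σ x → (σ x : ℕ) < i) →
      (stepsBelow (stepWord σ) 1 i).card ≤ (stepsBelow (stepWord σ) (-1) i).card := by
    intro i hi
    refine Finset.card_le_card_of_injOn σ (fun x hx => ?_) σ.injective.injOn
    simp only [Finset.mem_coe, mem_stepsBelow, stepWord_eq_one, stepWord_eq_neg_one, hσ x] at hx ⊢
    exact ⟨hi x hx.1 hx.2, hx.2⟩
  refine ⟨fun i => ?_, fun i hi => ?_, ?_⟩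
  · rw [pathHeight_eq_card_sub_card]
    have := le (i + 1)
    omega
  · rw [stepWord_eq_zero] at hi
    rw [pathHeight_eq_card_sub_card]
    have h1 := le i
    have h2 := ge i fun x hx hx' => by
      by_contra hlt
      rcases lt_or_eq_of_le (not_lt.1 hlt) with hlt | heq
      · exact h ⟨x, i, σ x, hx, hlt, by rw [hσ x, hi]; exact hx, by rw [hi]; exact hlt⟩
      · have hx2 : σ x = i := Fin.ext heq.symm
        have := hσ x
        rw [hx2, hi] at this
        rw [this] at hx
        exact lt_irrefl _ hx
    omega
  · rw [pathHeight_eq_card_sub_card]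
    have h1 := le (m + 1)
    have h2 := ge (m + 1) fun x _ _ => (σ x).isLt
    omega

lemma apply_lt_apply_of_not_contains321 {σ : Perm (Fin (m + 1))} (hσ : Function.Involutive σ)
    (h : ¬ Contains321 σ) {x y : Fin (m + 1)} (hxy : x < y) (hy : y < σ y) : σ x < σ y := by
  by_contra hlt
  have hlt' := lt_of_le_of_ne (not_lt.1 hlt) (σ.injective.ne hxy.ne')
  exact h ⟨x, y, σ x, hxy, hy.trans hlt', by rw [hσ x]; exact hxy.trans hy, hlt'⟩

lemma not_apply_lt_apply_of_stepWord_eq {σ τ : Perm (Fin (m + 1))} (hσ : Function.Involutive σ)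
    (hτ : Function.Involutive τ) (h : ¬ Contains321 τ) (e : stepWord σ = stepWord τ)
    {x : Fin (m + 1)} (hx : x < σ x) (ih : ∀ y < x, y < σ y → σ y = τ y) : ¬ σ x < τ x := by
  intro hlt
  have hc : τ (σ x) < σ x := by
    rw [← stepWord_eq_neg_one, ← e, stepWord_eq_neg_one, hσ x]; exact hx
  have hxτ : x < τ x := hx.trans hlt
  have hy : τ (σ x) < x := by
    by_contra hge
    rcases lt_or_eq_of_le (not_lt.1 hge) with hgt | heq
    · have := apply_lt_apply_of_not_contains321 hτ h hgt (by rw [hτ]; exact hc)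
      rw [hτ] at this
      exact lt_asymm hlt this
    · have := congrArg τ heq
      rw [hτ] at this
      exact hlt.ne this.symm
  have ho : τ (σ x) < σ (τ (σ x)) := by
    rw [← stepWord_eq_one, e, stepWord_eq_one, hτ]; exact hc
  have := ih _ hy ho
  rw [hτ] at this
  exact hy.ne (σ.injective this)

lemma eq_of_stepWord_eq {σ τ : Perm (Fin (m + 1))} (hσ : Function.Involutive σ)
    (hτ : Function.Involutive τ) (h : ¬ Contains321 σ) (h' : ¬ Contains321 τ)
    (e : stepWord σ = stepWord τ) : σ = τ := by
  have up : ∀ x, x < σ x → σ x = τ x := by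
    intro x
    induction x using WellFoundedLT.induction with
    | _ x ih =>
      intro hx
      have hx' : x < τ x := by rwa [← stepWord_eq_one, ← e, stepWord_eq_one]
      refine le_antisymm (not_lt.1 ?_) (not_lt.1 ?_)
      · refine not_apply_lt_apply_of_stepWord_eq hτ hσ h e.symm hx' fun y hy hy' => ?_
        rw [← stepWord_eq_one, ← e, stepWord_eq_one] at hy'
        exact (ih y hy hy').symm
      · exact not_apply_lt_apply_of_stepWord_eq hσ hτ h' e hx ih
  refine Equiv.ext fun x => ?_
  rcases SignType.eq_one_or_eq_neg_one_or_eq_zero (stepWord σ x) with hx | hx | hx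
  · exact up x (stepWord_eq_one.1 hx)
  · have := up (σ x) (by rw [hσ x]; exact stepWord_eq_neg_one.1 hx)
    rw [hσ x] at this
    rw [← hτ (σ x), ← this]
  · rw [stepWord_eq_zero.1 hx]
    rw [e, stepWord_eq_zero] at hx
    exact hx.symm

lemma exists_involutive_swapping {n : ℕ} {t : Fin n → SignType} (ht : IsPath 0 t) :
    ∃ g : Fin n → Fin n, Function.Involutive g ∧ (∀ x, t (g x) = -t x) ∧
      (∀ x, t x = 0 → g x = x) ∧ ∀ x y, t x ≠ 0 → t x = t y → x < y → g x < g y := by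
  have hc : (stepsBelow t 1 n).card = (stepsBelow t (-1) n).card := by
    have := ht.2.2
    rw [pathHeight_eq_card_sub_card] at this
    omega
  let e := ((stepsBelow t 1 n).orderIsoOfFin hc).symm.trans
    ((stepsBelow t (-1) n).orderIsoOfFin rfl)
  have hO : ∀ x, t x = 1 → x ∈ stepsBelow t 1 n := fun x hx => mem_stepsBelow.2 ⟨x.isLt, hx⟩
  have hC : ∀ x, t x = -1 → x ∈ stepsBelow t (-1) n := fun x hx => mem_stepsBelow.2 ⟨x.isLt, hx⟩
  have hne : (-1 : SignType) ≠ 1 := by decide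
  let g : Fin n → Fin n := fun x =>
    if h : t x = 1 then e ⟨x, hO x h⟩ else if h' : t x = -1 then e.symm ⟨x, hC x h'⟩ else x
  have g1 : ∀ x (h : t x = 1), g x = e ⟨x, hO x h⟩ := fun x h => dif_pos h
  have g2 : ∀ x (h : t x = -1), g x = e.symm ⟨x, hC x h⟩ := fun x h => by
    simp only [g]
    rw [dif_neg (by rw [h]; exact hne), dif_pos h]
  have g3 : ∀ x, t x = 0 → g x = x := fun x h => by simp [g, h]
  have t1 : ∀ x, t x = 1 → t (g x) = -1 := fun x h => by
    rw [g1 x h]; exact (mem_stepsBelow.1 (e ⟨x, hO x h⟩).2).2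
  have t2 : ∀ x, t x = -1 → t (g x) = 1 := fun x h => by
    rw [g2 x h]; exact (mem_stepsBelow.1 (e.symm ⟨x, hC x h⟩).2).2
  refine ⟨g, fun x => ?_, fun x => ?_, g3, fun x y hx hxy hlt => ?_⟩
  · rcases SignType.eq_one_or_eq_neg_one_or_eq_zero (t x) with h | h | h
    · rw [g2 _ (t1 x h)]
      simp only [g1 x h, Subtype.coe_eta, OrderIso.symm_apply_apply]
    · rw [g1 _ (t2 x h)]
      simp only [g2 x h, Subtype.coe_eta, OrderIso.apply_symm_apply]
    · rw [g3 x h, g3 x h]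
  · rcases SignType.eq_one_or_eq_neg_one_or_eq_zero (t x) with h | h | h
    · rw [t1 x h, h]
    · rw [t2 x h, h]; rfl
    · rw [g3 x h, h]; rfl
  · rcases SignType.eq_one_or_eq_neg_one_or_eq_zero (t x) with h | h | h
    · rw [g1 x h, g1 y (hxy ▸ h)]
      exact e.strictMono (Subtype.mk_lt_mk.2 hlt)
    · rw [g2 x h, g2 y (hxy ▸ h)]
      exact e.symm.strictMono (Subtype.mk_lt_mk.2 hlt)
    · exact absurd h hx

lemma exists_stepWord_eq {t : Fin (m + 1) → SignType} (ht : IsPath 0 t) :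
    ∃ σ : Perm (Fin (m + 1)), Function.Involutive σ ∧ ¬ Contains321 σ ∧ stepWord σ = t := by
  obtain ⟨g, hg, hneg, hfix, hmono⟩ := exists_involutive_swapping ht
  have hn1 : (-1 : SignType) ≠ 0 := by decide
  have hne : (-1 : SignType) ≠ 1 := by decide
  have up : ∀ x, t x = 1 → x < g x := by
    intro x hx
    have hgx : t (g x) = -1 := by rw [hneg, hx]
    by_contra hlt
    have hlt : g x < x := lt_of_le_of_ne (not_lt.1 hlt) fun h => by
      rw [h, hx] at hgx; exact hne hgx.symm
    have h1 : (stepsBelow t 1 (g x + 1)).card < (stepsBelow t 1 (x + 1)).card := by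
      refine Finset.card_lt_card ⟨fun y hy => ?_, fun hs => ?_⟩
      · rw [mem_stepsBelow] at hy ⊢
        rw [Fin.lt_def] at hlt
        exact ⟨by omega, hy.2⟩
      · have := (mem_stepsBelow.1 (hs (mem_stepsBelow.2 ⟨Nat.lt_succ_self _, hx⟩))).1
        rw [Fin.lt_def] at hlt
        omega
    have h2 : (stepsBelow t 1 (x + 1)).card ≤ (stepsBelow t (-1) (g x + 1)).card := by
      refine Finset.card_le_card_of_injOn g (fun y hy => ?_) hg.injective.injOn
      simp only [Finset.mem_coe, mem_stepsBelow, Nat.lt_succ_iff] at hy ⊢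
      refine ⟨?_, by rw [hneg, hy.2]⟩
      rcases lt_or_eq_of_le hy.1 with h | h
      · exact (hmono y x (by rw [hy.2]; exact one_ne_zero) (by rw [hy.2, hx]) h).le
      · rw [Fin.ext h]
    have h3 := ht.1 (g x)
    rw [pathHeight_eq_card_sub_card] at h3
    omega
  have down : ∀ x, t x = -1 → g x < x := fun x hx => by
    have := up (g x) (by rw [hneg, hx]; rfl)
    rwa [hg] at this
  refine ⟨hg.toPerm, hg, ?_, ?_⟩
  · rintro ⟨i, j, k, hij, hjk, h1, h2⟩
    simp only [Function.Involutive.coe_toPerm] at h1 h2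
    have closer : ∀ x y, x < y → g y < g x → t x ≠ 1 → t y = -1 := by
      intro x y hxy hg' hx
      have hxx : g x ≤ x := by
        rcases SignType.eq_one_or_eq_neg_one_or_eq_zero (t x) with h | h | h
        · exact absurd h hx
        · exact (down x h).le
        · exact (hfix x h).le
      have hyy : g y < y := hg'.trans (hxx.trans_lt hxy)
      rcases SignType.eq_one_or_eq_neg_one_or_eq_zero (t y) with h | h | h
      · exact absurd (up y h) hyy.not_gt
      · exact h
      · exact absurd (hfix y h) hyy.ne
    have contra : ∀ x y, x < y → g y < g x → t x = -1 → t y = -1 → False := fun x y hxy hg' hx hy =>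
      (hmono x y (by rw [hx]; exact hn1) (hx.trans hy.symm) hxy).not_gt hg'
    by_cases hi : t i = 1
    · rcases SignType.eq_one_or_eq_neg_one_or_eq_zero (t j) with hj | hj | hj
      · exact (hmono i j (by rw [hi]; exact one_ne_zero) (hi.trans hj.symm) hij).not_gt h2
      · exact contra j k hjk h1 hj (closer j k hjk h1 (by rw [hj]; exact hne))
      · have hgj := hfix j hj
        have h3 := ht.2.1 j hj
        rw [pathHeight_eq_card_sub_card] at h3
        have hmem : i ∈ stepsBelow t 1 j := mem_stepsBelow.2 ⟨hij, hi⟩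
        have h4 : (stepsBelow t (-1) j).card ≤ ((stepsBelow t 1 j).erase i).card := by
          refine Finset.card_le_card_of_injOn g (fun y hy => ?_) hg.injective.injOn
          simp only [Finset.mem_coe, mem_stepsBelow, Finset.mem_erase] at hy ⊢
          refine ⟨fun hyi => ?_, lt_trans (Fin.lt_def.1 (down y hy.2)) hy.1, ?_⟩
          · rw [← hyi, hg, hgj] at h2
            exact lt_asymm h2 hy.1
          · rw [hneg, hy.2]; rfl
        have := Finset.card_erase_lt_of_mem hmem
        omega
    · have hj := closer i j hij h2 hi
      exact contra j k hjk h1 hj (closer j k hjk h1 (by rw [hj]; exact hne))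
  · funext x
    rcases SignType.eq_one_or_eq_neg_one_or_eq_zero (t x) with h | h | h <;> rw [h]
    · exact stepWord_eq_one.2 (up x h)
    · exact stepWord_eq_neg_one.2 (down x h)
    · exact stepWord_eq_zero.2 (hfix x h)

lemma apply_succ_lt_apply_castSucc_iff {σ : Perm (Fin (m + 1))} (hσ : Function.Involutive σ)
    (h : ¬ Contains321 σ) (i : Fin m) :
    σ i.succ < σ i.castSucc ↔ stepWord σ i.castSucc = 1 ∧ stepWord σ i.succ = -1 := by
  rw [stepWord_eq_one, stepWord_eq_neg_one]
  have hi : i.castSucc < i.succ := Fin.castSucc_lt_succ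
  refine ⟨fun hd => ⟨?_, ?_⟩, fun ⟨h1, h2⟩ => ?_⟩
  · by_contra hlt
    have hle := not_lt.1 hlt
    exact h ⟨σ i.succ, i.castSucc, i.succ, hd.trans_le hle, hi, hd, by
      rw [hσ]; exact hle.trans_lt hi⟩
  · by_contra hlt
    have hle := not_lt.1 hlt
    exact h ⟨i.castSucc, i.succ, σ i.castSucc, hi, hle.trans_lt hd, by
      rw [hσ]; exact hi.trans_le hle, hd⟩
  · simp only [Fin.lt_def, Fin.val_castSucc, Fin.val_succ] at *
    omega

lemma majorIndex_eq_peakSum {w : (typeA m).Group} (hw : Function.Involutive (toPerm m w))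
    (h : ¬ Contains321 (toPerm m w)) :
    majorIndex (typeA m).toCoxeterSystem w = peakSum (stepWord (toPerm m w)) := by
  rw [majorIndex, rightDescents, Finset.sum_filter, peakSum]
  refine Finset.sum_congr rfl fun i _ => ?_
  simp only [length_mul_simple_lt_iff, apply_succ_lt_apply_castSucc_iff hw h]

lemma isFCInvolution_iff (w : (typeA m).Group) :
    IsFCInvolution (typeA m).toCoxeterSystem w ↔
      ¬ Contains321 (toPerm m w) ∧ Function.Involutive (toPerm m w) := by
  rw [IsFCInvolution, isFullyCommutative_iff, ← toPerm_injective.eq_iff, map_mul, map_one,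
    Equiv.ext_iff]
  rfl

end Bijection

/-- The sum of `q^{maj(w)}` over all fully commutative involutions `w` of the Coxeter
group of type `A_{n-1}` equals the Gaussian binomial coefficient `[n choose ⌊n/2⌋]_q`.
(The existence of the finset `S` expresses that the set of fully commutative involutions
is finite.) -/
theorem majorIndex_gf_fcInvolutions_typeA (n : ℕ) (hn : 1 ≤ n) :
    ∃ S : Finset (typeA (n - 1)).Group,
      (∀ w, w ∈ S ↔ IsFCInvolution (typeA (n - 1)).toCoxeterSystem w) ∧
      ∑ w ∈ S, (Polynomial.X : Polynomial ℤ) ^ majorIndex (typeA (n - 1)).toCoxeterSystem w =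
        qbinom n (n / 2) := by
  classical
  obtain ⟨m, rfl⟩ : ∃ m, n = m + 1 := ⟨n - 1, by omega⟩
  change ∃ S : Finset (typeA m).Group, (∀ w, w ∈ S ↔ IsFCInvolution (typeA m).toCoxeterSystem w) ∧
    ∑ w ∈ S, (Polynomial.X : Polynomial ℤ) ^ majorIndex (typeA m).toCoxeterSystem w =
      qbinom (m + 1) ((m + 1) / 2)
  have : Finite (typeA m).Group := Finite.of_injective _ toPerm_injective
  have mem : ∀ w, w ∈ (Set.toFinite {w | IsFCInvolution (typeA m).toCoxeterSystem w}).toFinset ↔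
      IsFCInvolution (typeA m).toCoxeterSystem w := fun w => Set.Finite.mem_toFinset _
  refine ⟨_, mem, ?_⟩
  rw [← sum_isPath_zero]
  refine Finset.sum_nbij (fun w => stepWord (toPerm m w)) (fun w hw => ?_) (fun w hw v hv e => ?_)
    (fun t ht => ?_) (fun w hw => ?_)
  · obtain ⟨h1, h2⟩ := (isFCInvolution_iff w).1 ((mem w).1 hw)
    exact Finset.mem_filter.2 ⟨Finset.mem_univ _, isPath_stepWord h2 h1⟩
  · obtain ⟨h1, h2⟩ := (isFCInvolution_iff w).1 ((mem w).1 hw)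
    obtain ⟨h3, h4⟩ := (isFCInvolution_iff v).1 ((mem v).1 hv)
    exact toPerm_injective (eq_of_stepWord_eq h2 h4 h1 h3 e)
  · obtain ⟨σ, h1, h2, rfl⟩ := exists_stepWord_eq (Finset.mem_filter.1 ht).2
    obtain ⟨w, rfl⟩ := toPerm_surjective σ
    exact ⟨w, (mem w).2 ((isFCInvolution_iff w).2 ⟨h2, h1⟩), rfl⟩
  · obtain ⟨h1, h2⟩ := (isFCInvolution_iff w).1 ((mem w).1 hw)
    rw [majorIndex_eq_peakSum h2 h1]
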